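/- arXiv:1110.6675 — 2 statements merged into one kernel-verified Lean document; each statement's English description precedes it below -/
import Mathlib

section
/- Let m ≥ 1 and consider the polynomial ring ℂ[x_1, …, x_m, ξ_1, …, ξ_m] in 2m variables. Let L_i = x_i²ξ_i² − x_i(∑_{j=1}^m x_j ξ_j)² for i = 1, …, m. Then the Krull dimension of the quotient ring ℂ[x_1, …, x_m, ξ_1, …, ξ_m] / ⟨L_1, …, L_m⟩ equals m. (Equivalently, the affine variety V(L_1, …, L_m) ⊂ ℂ^{2m} has dimension m; this proves that the Lauricella F_C system I(m) is holonomic.) -/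
open MvPolynomial

/-- Along an integral ring homomorphism the Krull dimension does not increase. -/
theorem RingHom.IsIntegral.ringKrullDim_le {R S : Type*} [CommRing R] [CommRing S] {f : R →+* S}
    (hf : f.IsIntegral) : ringKrullDim S ≤ ringKrullDim R := by
  algebraize [f]
  refine Order.krullDim_le_of_strictMono (PrimeSpectrum.comap (algebraMap R S)) fun p q hpq ↦ ?_
  exact Ideal.IsIntegral.comap_lt_comap (R := R) (I := p.asIdeal) (J := q.asIdeal) hpq

/-- The Krull dimension of a finitely generated algebra over a field is bounded by its
transcendence degree. -/
theorem ringKrullDim_le_of_trdeg_le {k A : Type*} [Field k] [CommRing A] [Nontrivial A]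
    [Algebra k A] [Algebra.FiniteType k A] {n : ℕ} (h : Algebra.trdeg k A ≤ n) :
    ringKrullDim A ≤ n := by
  obtain ⟨s, g, hinj, hint⟩ := exists_integral_inj_algHom_of_fg k A
  have hs : s ≤ n := by
    have hle := (lift_trdeg_le_of_injective g hinj).trans (Cardinal.lift_le.mpr h)
    rw [MvPolynomial.trdeg_of_isDomain] at hle
    simpa using hle
  calc ringKrullDim A ≤ ringKrullDim (MvPolynomial (Fin s) k) := hint.ringKrullDim_le
    _ = s := by simp
    _ ≤ n := by exact_mod_cast hs

theorem ringKrullDim_le_of_forall_quotient_le {A : Type*} [CommRing A] {n : WithBot ℕ∞}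
    (h : ∀ P : Ideal A, P.IsPrime → ringKrullDim (A ⧸ P) ≤ n) : ringKrullDim A ≤ n := by
  rw [ringKrullDim, Order.krullDim_eq_iSup_coheight]
  refine iSup_le fun p ↦ ?_
  have hIci : Set.Ici p = PrimeSpectrum.zeroLocus (p.asIdeal : Set A) := rfl
  rw [Order.coheight_eq_krullDim_Ici, hIci, ← ringKrullDim_quotient]
  exact h p.asIdeal p.isPrime

theorem isAlgebraic_of_mul_mem {D B : Type*} [CommRing D] [IsDomain D] [SetLike B D]
    [SubringClass B D] {b : B} {r a : D} (hr : r ∈ b) (hr0 : r ≠ 0) (hra : r * a ∈ b) :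
    IsAlgebraic b a := by
  refine ⟨Polynomial.C ⟨r, hr⟩ * Polynomial.X - Polynomial.C ⟨r * a, hra⟩, fun h0 ↦ hr0 ?_, ?_⟩
  · simpa using congrArg (fun p : Polynomial b ↦ ((p.coeff 1 : b) : D)) h0
  · simp [Algebra.algebraMap_ofSubsemiring_apply]

/-- A domain generated by solutions `x`, `ξ` of the equations `x_i² ξ_i² = x_i (∑_j x_j ξ_j)²`,
`1 ≤ i ≤ m`, has transcendence degree at most `m`. -/
theorem trdeg_le_of_lauricella {k D : Type*} [Field k] [CommRing D] [IsDomain D] [Algebra k D]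
    {m : ℕ} (x ξ : Fin m → D) (hgen : Algebra.adjoin k (Set.range x ∪ Set.range ξ) = ⊤)
    (hL : ∀ i, x i ^ 2 * ξ i ^ 2 = x i * (∑ j, x j * ξ j) ^ 2) :
    Algebra.trdeg k D ≤ m := by
  classical
  set S := ∑ j, x j * ξ j
  let z : Fin m → D := fun i ↦
    if x i = 0 then ξ i else if ξ i = 0 then x i else x i * ξ i
  let B := Algebra.adjoin k (Set.range z)
  have hz : ∀ i, z i ∈ B := fun i ↦ Algebra.subset_adjoin ⟨i, rfl⟩
  have hy : ∀ i, x i * ξ i ∈ B := fun i ↦ by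
    by_cases h : x i * ξ i = 0
    · rw [h]; exact B.zero_mem
    · simpa [z, left_ne_zero_of_mul h, right_ne_zero_of_mul h] using hz i
  have hSB : S ∈ B := B.sum_mem fun i _ ↦ hy i
  have hS0 : ∀ i, x i * ξ i ≠ 0 → S ≠ 0 := fun i hi h0 ↦ by
    have h := hL i
    rw [h0, ← mul_pow] at h
    exact hi (by simpa using h)
  have hmul : ∀ i, x i * ξ i ≠ 0 → x i * ξ i * ξ i = S ^ 2 := fun i hi ↦
    mul_left_cancel₀ (left_ne_zero_of_mul hi) (by linear_combination hL i)
  have hmem : ∀ a ∈ B, IsAlgebraic B a := fun a ha ↦ isAlgebraic_algebraMap (⟨a, ha⟩ : B)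
  have hx : ∀ i, IsAlgebraic B (x i) := fun i ↦ by
    by_cases h : x i * ξ i = 0
    · by_cases h' : x i = 0
      · rw [h']; exact isAlgebraic_zero
      · exact hmem _ (by simpa [z, h', (mul_eq_zero.mp h).resolve_left h'] using hz i)
    · refine isAlgebraic_of_mul_mem (pow_mem hSB 2) (pow_ne_zero 2 (hS0 i h)) ?_
      rw [mul_comm, ← hL i, ← mul_pow]
      exact pow_mem (hy i) 2
  have hξ : ∀ i, IsAlgebraic B (ξ i) := fun i ↦ by
    by_cases h : x i * ξ i = 0
    · by_cases h' : x i = 0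
      · exact hmem _ (by simpa [z, h'] using hz i)
      · rw [(mul_eq_zero.mp h).resolve_left h']; exact isAlgebraic_zero
    · refine isAlgebraic_of_mul_mem (hy i) h ?_
      rw [hmul i h]
      exact pow_mem hSB 2
  have halg : Algebra.IsAlgebraic B D := by
    refine ⟨fun a ↦ ?_⟩
    have hle : Algebra.adjoin k (Set.range x ∪ Set.range ξ) ≤
        (Subalgebra.algebraicClosure B D).restrictScalars k := by
      refine Algebra.adjoin_le ?_
      rintro _ (⟨i, rfl⟩ | ⟨i, rfl⟩)
      exacts [hx i, hξ i]
    exact hle (hgen ▸ Algebra.mem_top)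
  refine (Algebra.IsAlgebraic.trdeg_le_cardinalMk k (Set.range z)).trans ?_
  simpa using Cardinal.mk_range_le_lift (f := z)

/-- in `ℂ[x_1, …, x_m, ξ_1, …, ξ_m]` (variables indexed by
`Fin m ⊕ Fin m`, with `x_i = X (inl i)` and `ξ_i = X (inr i)`), the quotient by
the ideal generated by the principal symbols
`L_i = x_i² ξ_i² − x_i (∑_j x_j ξ_j)²` has Krull dimension `m`;
this proves that the Lauricella `F_C` system `I(m)` is holonomic. -/
theorem lauricella_char_ideal_krullDim (m : ℕ) (hm : 1 ≤ m) :
    ringKrullDim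
      (MvPolynomial (Fin m ⊕ Fin m) ℂ ⧸
        Ideal.span (Set.range (fun i : Fin m =>
          (X (Sum.inl i) : MvPolynomial (Fin m ⊕ Fin m) ℂ) ^ 2 *
              X (Sum.inr i) ^ 2 -
            X (Sum.inl i) *
              (∑ j : Fin m, X (Sum.inl j) * X (Sum.inr j)) ^ 2))) = m := by
  set I := Ideal.span (Set.range (fun i : Fin m =>
    (X (Sum.inl i) : MvPolynomial (Fin m ⊕ Fin m) ℂ) ^ 2 * X (Sum.inr i) ^ 2 -
      X (Sum.inl i) * (∑ j : Fin m, X (Sum.inl j) * X (Sum.inr j)) ^ 2))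
  apply le_antisymm
  · refine ringKrullDim_le_of_forall_quotient_le fun P hP ↦ ?_
    refine ringKrullDim_le_of_trdeg_le (k := ℂ) ?_
    let π := (Ideal.Quotient.mkₐ ℂ P).comp (Ideal.Quotient.mkₐ ℂ I)
    have hπ : Function.Surjective π :=
      (Ideal.Quotient.mkₐ_surjective ℂ P).comp (Ideal.Quotient.mkₐ_surjective ℂ I)
    refine trdeg_le_of_lauricella (fun i ↦ π (X (Sum.inl i))) (fun i ↦ π (X (Sum.inr i))) ?_ ?_
    · have hrange : (Set.range fun i ↦ π (X (Sum.inl i))) ∪ (Set.range fun i ↦ π (X (Sum.inr i))) =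
          π '' Set.range X := by
        rw [← Set.range_comp, ← Set.Sum.elim_range]
        congr 1
        ext (i | i) <;> rfl
      rw [hrange, ← AlgHom.map_adjoin, adjoin_range_X, Algebra.map_top,
        (AlgHom.range_eq_top π).mpr hπ]
    · intro i
      have hmem : π (X (Sum.inl i) ^ 2 * X (Sum.inr i) ^ 2 -
          X (Sum.inl i) * (∑ j : Fin m, X (Sum.inl j) * X (Sum.inr j)) ^ 2) = 0 := by
        have : Ideal.Quotient.mk I (X (Sum.inl i) ^ 2 * X (Sum.inr i) ^ 2 -
            X (Sum.inl i) * (∑ j : Fin m, X (Sum.inl j) * X (Sum.inr j)) ^ 2) = 0 :=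
          Ideal.Quotient.eq_zero_iff_mem.mpr (Ideal.subset_span ⟨i, rfl⟩)
        simp only [π, AlgHom.comp_apply, Ideal.Quotient.mkₐ_eq_mk, this, map_zero]
      simpa [sub_eq_zero] using hmem
  · let ψ : MvPolynomial (Fin m ⊕ Fin m) ℂ →ₐ[ℂ] MvPolynomial (Fin m) ℂ :=
      aeval (Sum.elim (fun _ ↦ 0) X)
    have hψ : Function.Surjective ψ := fun p ↦
      ⟨rename Sum.inr p, by simp only [ψ, aeval_rename, Sum.elim_comp_inr, aeval_X_left_apply]⟩
    have hdim : ringKrullDim (MvPolynomial (Fin m) ℂ) = m := by simp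
    rw [← hdim]
    refine ringKrullDim_le_of_surjective (Ideal.Quotient.lift _ ψ.toRingHom fun a ha ↦ ?_)
      (Ideal.Quotient.lift_surjective_of_surjective _ _ hψ)
    refine (Ideal.span_le (I := RingHom.ker ψ)).mpr ?_ ha
    rintro _ ⟨i, rfl⟩
    simp [ψ, RingHom.mem_ker]
end

section
/- Let m ≥ 1 and let e_1, …, e_{m+2} be the standard basis of ℤ^{m+2}. Consider the ℂ-algebra homomorphism φ from the polynomial ring ℂ[u_1, …, u_{m+1}, u_{−1}, …, u_{−(m+1)}] in 2(m+1) variables to the group algebra ℂ[ℤ^{m+2}] determined by φ(u_j) = t^{e_j + e_{m+2}} and φ(u_{−j}) = t^{−e_j + e_{m+2}} for j = 1, …, m+1 (where t^v denotes the basis element of the group algebra corresponding to v ∈ ℤ^{m+2}). Then the kernel of φ — i.e., the toric ideal I_A of the matrix A(F_C, m) whose columns are e_j + e_{m+2} and −e_j + e_{m+2} — equals the ideal generated by the m binomials u_j u_{−j} − u_{m+1} u_{−(m+1)}, j = 1, …, m. -/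
open MvPolynomial

/-- An algebra map on polynomials whose value on a monomial depends only on the image of the
exponent vector under `p ↦ ∑ p s • v s` vanishes on the kernel of the monomial map of `v`. -/
lemma eq_zero_of_aeval_single_eq_zero {R σ G S : Type*} [CommRing R] [Fintype σ]
    [AddCommMonoid G] [CommRing S] [Algebra R S] (v : σ → G) (π : MvPolynomial σ R →ₐ[R] S)
    (ψ : G → S) (h : ∀ p : σ →₀ ℕ, π (monomial p 1) = ψ (∑ s, p s • v s))
    {f : MvPolynomial σ R}
    (hf : aeval (fun s => AddMonoidAlgebra.single (v s) (1 : R)) f = 0) : π f = 0 := by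
  let L : AddMonoidAlgebra R G →ₗ[R] S :=
    Finsupp.linearCombination R ψ ∘ₗ (AddMonoidAlgebra.coeffLinearEquiv R).toLinearMap
  have key : ∀ g : MvPolynomial σ R,
      L (aeval (fun s => AddMonoidAlgebra.single (v s) (1 : R)) g) = π g := by
    intro g
    induction g using MvPolynomial.induction_on' with
    | monomial p c =>
      have hc : monomial p c = c • monomial p (1 : R) := by simp [smul_monomial]
      rw [hc, map_smul, map_smul, map_smul, h, aeval_monomial,
        Finsupp.prod_fintype _ _ (fun _ => pow_zero _)]
      simp [L, AddMonoidAlgebra.single_pow, AddMonoidAlgebra.prod_single]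
    | add g₁ g₂ h₁ h₂ => simp only [map_add, h₁, h₂]
  rw [← key, hf, map_zero]

/-- If all products `x j * y j` equal `z`, then a monomial in the `x j` and `y j` is reduced by
pulling out as many factors `z` as possible. -/
lemma prod_pow_mul_prod_pow_eq {ι S : Type*} [Fintype ι] [CommMonoid S] {x y : ι → S} {z : S}
    (h : ∀ j, x j * y j = z) (a b : ι → ℕ) :
    (∏ j, x j ^ a j) * ∏ j, y j ^ b j =
      (∏ j, x j ^ (a j - b j) * y j ^ (b j - a j)) * z ^ ∑ j, min (a j) (b j) := by
  rw [← Finset.prod_pow_eq_pow_sum, ← Finset.prod_mul_distrib, ← Finset.prod_mul_distrib]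
  refine Finset.prod_congr rfl fun j _ => ?_
  rw [← h j, mul_pow, mul_mul_mul_comm, ← pow_add, ← pow_add]
  congr 2 <;> omega

/-- The columns of the matrix `A(F_C, m)`. -/
def lauricellaColumn (m : ℕ) : Fin (m + 1) ⊕ Fin (m + 1) → Fin (m + 2) → ℤ :=
  Sum.elim (fun j => Pi.single j.castSucc 1 + Pi.single (Fin.last (m + 1)) 1)
    (fun j => -Pi.single j.castSucc 1 + Pi.single (Fin.last (m + 1)) 1)

lemma sum_smul_lauricellaColumn_castSucc (m : ℕ) (p : Fin (m + 1) ⊕ Fin (m + 1) → ℕ)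
    (j : Fin (m + 1)) :
    (∑ s, p s • lauricellaColumn m s) j.castSucc = (p (Sum.inl j) : ℤ) - p (Sum.inr j) := by
  simp [lauricellaColumn, Fintype.sum_sum_type, Finset.sum_apply, Pi.single_apply,
    (Fin.castSucc_lt_last j).ne, sub_eq_add_neg]

lemma sum_smul_lauricellaColumn_last (m : ℕ) (p : Fin (m + 1) ⊕ Fin (m + 1) → ℕ) :
    (∑ s, p s • lauricellaColumn m s) (Fin.last (m + 1)) =
      ∑ j, ((p (Sum.inl j) : ℤ) + p (Sum.inr j)) := by
  simp [lauricellaColumn, Fintype.sum_sum_type, Finset.sum_apply,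
    (Fin.castSucc_lt_last _).ne', Finset.sum_add_distrib]

/-- The reduced monomial attached to a lattice vector, evaluated at `x`, `y` and `z`. -/
def lauricellaNormalForm {S : Type*} [CommMonoid S] (m : ℕ) (x y : Fin (m + 1) → S) (z : S)
    (w : Fin (m + 2) → ℤ) : S :=
  (∏ j : Fin (m + 1), x j ^ (w j.castSucc).toNat * y j ^ (-w j.castSucc).toNat) *
    z ^ ((w (Fin.last (m + 1)) - ∑ j : Fin (m + 1), |w j.castSucc|) / 2).toNat

lemma prod_pow_eq_lauricellaNormalForm {S : Type*} [CommMonoid S] (m : ℕ)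
    {x y : Fin (m + 1) → S} {z : S} (h : ∀ j, x j * y j = z)
    (p : Fin (m + 1) ⊕ Fin (m + 1) → ℕ) :
    (∏ j, x j ^ p (Sum.inl j)) * ∏ j, y j ^ p (Sum.inr j) =
      lauricellaNormalForm m x y z (∑ s, p s • lauricellaColumn m s) := by
  rw [prod_pow_mul_prod_pow_eq h (fun j => p (Sum.inl j)) (fun j => p (Sum.inr j)),
    lauricellaNormalForm]
  simp only [sum_smul_lauricellaColumn_castSucc, sum_smul_lauricellaColumn_last]
  congr 1
  · refine Finset.prod_congr rfl fun j _ => ?_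
    congr 2 <;> omega
  · have hsum : ∑ j, ((p (Sum.inl j) : ℤ) + p (Sum.inr j)) -
        ∑ j, |(p (Sum.inl j) : ℤ) - p (Sum.inr j)| =
        2 * ((∑ j, min (p (Sum.inl j)) (p (Sum.inr j)) : ℕ) : ℤ) := by
      rw [← Finset.sum_sub_distrib, Nat.cast_sum, Finset.mul_sum]
      refine Finset.sum_congr rfl fun j _ => ?_
      rcases le_total (p (Sum.inl j)) (p (Sum.inr j)) with hj | hj
      · rw [min_eq_left hj, abs_of_nonpos (by omega)]; omega
      · rw [min_eq_right hj, abs_of_nonneg (by omega)]; omega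
    rw [hsum]
    congr 1
    omega

/-- the toric ideal of the matrix `A(F_C, m)` (columns
`e_j + e_{m+2}` and `−e_j + e_{m+2}`, `j = 1, …, m+1`), i.e. the kernel of the
monomial map `φ : ℂ[u_1, …, u_{m+1}, u_{-1}, …, u_{-(m+1)}] → ℂ[ℤ^{m+2}]`
with `φ(u_j) = t^{e_j + e_{m+2}}`, `φ(u_{-j}) = t^{-e_j + e_{m+2}}`, equals the
ideal generated by the `m` binomials `u_j u_{-j} − u_{m+1} u_{-(m+1)}`,
`j = 1, …, m`.  The variables are indexed by `Fin (m+1) ⊕ Fin (m+1)`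
(`inl j ↦ u_{j+1}`, `inr j ↦ u_{-(j+1)}`), and the group algebra of `ℤ^{m+2}`
is `AddMonoidAlgebra ℂ (Fin (m+2) → ℤ)`. -/
theorem lauricella_toric_ideal (m : ℕ) (hm : 1 ≤ m) :
    RingHom.ker
      ((aeval (R := ℂ) (fun s : Fin (m + 1) ⊕ Fin (m + 1) =>
        match s with
        | Sum.inl j => AddMonoidAlgebra.single
            (Pi.single j.castSucc 1 + Pi.single (Fin.last (m + 1)) 1 :
              Fin (m + 2) → ℤ) (1 : ℂ)
        | Sum.inr j => AddMonoidAlgebra.single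
            (-Pi.single j.castSucc 1 + Pi.single (Fin.last (m + 1)) 1 :
              Fin (m + 2) → ℤ) (1 : ℂ))) :
        MvPolynomial (Fin (m + 1) ⊕ Fin (m + 1)) ℂ →+*
          AddMonoidAlgebra ℂ (Fin (m + 2) → ℤ)) =
    Ideal.span (Set.range (fun j : Fin m =>
      (X (Sum.inl j.castSucc) * X (Sum.inr j.castSucc) -
        X (Sum.inl (Fin.last m)) * X (Sum.inr (Fin.last m)) :
          MvPolynomial (Fin (m + 1) ⊕ Fin (m + 1)) ℂ))) := by
  have hcol : (fun s : Fin (m + 1) ⊕ Fin (m + 1) =>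
        match s with
        | Sum.inl j => AddMonoidAlgebra.single
            (Pi.single j.castSucc 1 + Pi.single (Fin.last (m + 1)) 1 :
              Fin (m + 2) → ℤ) (1 : ℂ)
        | Sum.inr j => AddMonoidAlgebra.single
            (-Pi.single j.castSucc 1 + Pi.single (Fin.last (m + 1)) 1 :
              Fin (m + 2) → ℤ) (1 : ℂ)) =
      fun s => AddMonoidAlgebra.single (lauricellaColumn m s) (1 : ℂ) := by
    funext s
    rcases s with j | j <;> rfl
  rw [hcol]
  set I := Ideal.span (Set.range (fun j : Fin m =>
      (X (Sum.inl j.castSucc) * X (Sum.inr j.castSucc) -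
        X (Sum.inl (Fin.last m)) * X (Sum.inr (Fin.last m)) :
          MvPolynomial (Fin (m + 1) ⊕ Fin (m + 1)) ℂ))) with hI
  apply le_antisymm
  · intro f hf
    let π := Ideal.Quotient.mkₐ ℂ I
    have hz : ∀ j, π (X (Sum.inl j)) * π (X (Sum.inr j)) =
        π (X (Sum.inl (Fin.last m)) * X (Sum.inr (Fin.last m))) := by
      refine Fin.lastCases (map_mul _ _ _).symm fun j => ?_
      rw [← map_mul]
      exact Ideal.Quotient.eq.2 (Ideal.subset_span ⟨j, rfl⟩)
    refine Ideal.Quotient.eq_zero_iff_mem.1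
      (eq_zero_of_aeval_single_eq_zero (lauricellaColumn m) π
        (lauricellaNormalForm m (fun j => π (X (Sum.inl j))) (fun j => π (X (Sum.inr j)))
          (π (X (Sum.inl (Fin.last m)) * X (Sum.inr (Fin.last m))))) (fun p => ?_) hf)
    rw [← prod_pow_eq_lauricellaNormalForm m hz, monomial_eq,
      Finsupp.prod_fintype _ _ (fun _ => pow_zero _)]
    simp [Fintype.prod_sum_type]
  · rw [hI, Ideal.span_le]
    rintro _ ⟨j, rfl⟩
    simp only [SetLike.mem_coe, RingHom.mem_ker, RingHom.coe_coe, map_sub, map_mul, aeval_X,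
      AddMonoidAlgebra.single_mul_single, sub_eq_zero]
    congr 1
    simp only [lauricellaColumn, Sum.elim_inl, Sum.elim_inr]
    abel
end
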